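/- Let k ≥ 1, p ≥ 0, and N be integers with k + p ≤ N − k. Let Σ₁ ∈ ℝ^{k×k} and Σ₂ ∈ ℝ^{(N−k)×(N−k)} be diagonal matrices with strictly positive diagonal entries. Let Q be Haar-distributed on the orthogonal group O(k+p) and H be Haar-distributed on O(N−k), independent of each other; let Q₁ ∈ ℝ^{(k+p)×k} be the first k columns of Q and H₁ ∈ ℝ^{(N−k)×(k+p)} the first k+p columns of H. Then the matrix H₁ᵀ Σ₂² H₁ is positive definite, the matrix Q₁ᵀ (H₁ᵀ Σ₂² H₁)^{−1} Q₁ is positive definite, and 𝔼[ tr( Σ₁^{−2} · ( Q₁ᵀ (H₁ᵀ Σ₂² H₁)^{−1} Q₁ )^{−1} ) ] ≤ tr(Σ₁^{−2}) · tr(Σ₂²) / (N−k). -/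

import Mathlib

open MeasureTheory Matrix

noncomputable section

/-- Matrices carry the product (Borel) measurable structure, entrywise. -/
instance (n ℓ : ℕ) : MeasurableSpace (Matrix (Fin n) (Fin ℓ) ℝ) := MeasurableSpace.pi

/-- The first `k` columns of an `n × n` matrix (`k ≤ n`). -/
def firstCols {n : ℕ} (k : ℕ) (hkn : k ≤ n) (Q : Matrix (Fin n) (Fin n) ℝ) :
    Matrix (Fin n) (Fin k) ℝ :=
  Q.submatrix id (Fin.castLE hkn)

theorem transpose_firstCols_mul_firstCols {n k : ℕ} (hkn : k ≤ n)
    (Q : Matrix.orthogonalGroup (Fin n) ℝ) :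
    (firstCols k hkn (Q : Matrix (Fin n) (Fin n) ℝ))ᵀ *
      firstCols k hkn (Q : Matrix (Fin n) (Fin n) ℝ) = 1 := by
  have h : (Q : Matrix (Fin n) (Fin n) ℝ)ᵀ * (Q : Matrix (Fin n) (Fin n) ℝ) = 1 :=
    (Matrix.mem_orthogonalGroup_iff' _ _).1 Q.2
  have h' := congrArg (fun M => M.submatrix (Fin.castLE hkn) (Fin.castLE hkn)) h
  simp only [Matrix.submatrix_one _ (Fin.castLE_injective hkn)] at h'
  rw [← h']
  rfl

theorem Matrix.PosDef.transpose_mul_mul_of_transpose_mul_self_eq_one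
    {m n : Type*} [Fintype m] [Fintype n] [DecidableEq n]
    {M : Matrix m m ℝ} (hM : M.PosDef) {X : Matrix m n ℝ} (hX : Xᵀ * X = 1) :
    (Xᵀ * M * X).PosDef := by
  rw [← Matrix.conjTranspose_eq_transpose_of_trivial]
  refine hM.conjTranspose_mul_mul_same (Function.LeftInverse.injective (g := Xᵀ.mulVec) ?_)
  intro v
  rw [Matrix.mulVec_mulVec, hX, Matrix.one_mulVec]

/-- For `X` with orthonormal columns, the compression of the inverse of a positive definite matrix
has inverse at most the compression of the matrix; here for diagonal entries. -/
theorem Matrix.PosDef.inv_compression_inv_diag_le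
    {m n : Type*} [Fintype m] [Fintype n] [DecidableEq m] [DecidableEq n]
    {M : Matrix m m ℝ} (hM : M.PosDef) {X : Matrix m n ℝ} (hX : Xᵀ * X = 1) (i : n) :
    (Xᵀ * M⁻¹ * X)⁻¹ i i ≤ (Xᵀ * M * X) i i := by
  have hS : (Xᵀ * M⁻¹ * X).PosDef := hM.inv.transpose_mul_mul_of_transpose_mul_self_eq_one hX
  set S := Xᵀ * M⁻¹ * X with hSdef
  have hSt : (S⁻¹)ᵀ = S⁻¹ := by
    simpa [Matrix.IsHermitian] using hS.inv.isHermitian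
  have hMt : (M⁻¹)ᵀ = M⁻¹ := by
    simpa [Matrix.IsHermitian] using hM.inv.isHermitian
  have hM1 : M * M⁻¹ = 1 := Matrix.mul_nonsing_inv _ hM.det_pos.ne'.isUnit
  have hM2 : M⁻¹ * M = 1 := Matrix.nonsing_inv_mul _ hM.det_pos.ne'.isUnit
  have hS2 : S⁻¹ * S = 1 := Matrix.nonsing_inv_mul _ hS.det_pos.ne'.isUnit
  have hpos := hM.posSemidef.conjTranspose_mul_mul_same (M⁻¹ * X * S⁻¹ - X)
  have hY : (M⁻¹ * X * S⁻¹ - X)ᴴ * M * (M⁻¹ * X * S⁻¹ - X) = Xᵀ * M * X - S⁻¹ := by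
    rw [Matrix.conjTranspose_eq_transpose_of_trivial, Matrix.mul_assoc]
    have h1 : M * (M⁻¹ * X * S⁻¹ - X) = X * S⁻¹ - M * X := by
      rw [Matrix.mul_sub, ← Matrix.mul_assoc, ← Matrix.mul_assoc, hM1, Matrix.one_mul]
    have h2 : (M⁻¹ * X * S⁻¹ - X)ᵀ = S⁻¹ * (Xᵀ * M⁻¹) - Xᵀ := by
      rw [Matrix.transpose_sub, Matrix.transpose_mul, Matrix.transpose_mul, hSt, hMt]
    have h3 : S⁻¹ * (Xᵀ * M⁻¹) * (X * S⁻¹) = S⁻¹ := by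
      rw [Matrix.mul_assoc, ← Matrix.mul_assoc (Xᵀ * M⁻¹) X, ← hSdef, ← Matrix.mul_assoc, hS2,
        Matrix.one_mul]
    have h4 : S⁻¹ * (Xᵀ * M⁻¹) * (M * X) = S⁻¹ := by
      rw [Matrix.mul_assoc, Matrix.mul_assoc Xᵀ, ← Matrix.mul_assoc M⁻¹, hM2, Matrix.one_mul, hX,
        Matrix.mul_one]
    have h5 : Xᵀ * (X * S⁻¹) = S⁻¹ := by
      rw [← Matrix.mul_assoc, hX, Matrix.one_mul]
    rw [h1, h2, Matrix.sub_mul, Matrix.mul_sub, Matrix.mul_sub, h3, h4, h5, ← Matrix.mul_assoc Xᵀ]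
    abel
  rw [hY] at hpos
  simpa using hpos.diag_nonneg (i := i)

theorem Matrix.inv_diagonal_sq {n : Type*} [Fintype n] [DecidableEq n] {d : n → ℝ}
    (hd : ∀ i, 0 < d i) :
    ((Matrix.diagonal d) ^ 2)⁻¹ = Matrix.diagonal fun i => (d i ^ 2)⁻¹ := by
  refine Matrix.inv_eq_right_inv ?_
  rw [Matrix.diagonal_pow, Matrix.diagonal_mul_diagonal, ← Matrix.diagonal_one]
  congr 1
  ext i
  simp [(hd i).ne']

instance (n ℓ : ℕ) : BorelSpace (Matrix (Fin n) (Fin ℓ) ℝ) :=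
  inferInstanceAs (BorelSpace (Fin n → Fin ℓ → ℝ))

instance (n ℓ : ℕ) : SecondCountableTopology (Matrix (Fin n) (Fin ℓ) ℝ) :=
  inferInstanceAs (SecondCountableTopology (Fin n → Fin ℓ → ℝ))

instance (n : ℕ) : BorelSpace (Matrix.orthogonalGroup (Fin n) ℝ) :=
  Subtype.borelSpace _

instance (n : ℕ) : SecondCountableTopology (Matrix.orthogonalGroup (Fin n) ℝ) :=
  TopologicalSpace.Subtype.secondCountableTopology _

/-- The permutation matrix of `σ` as an orthogonal matrix. -/
def orthogonalPerm {n : ℕ} (σ : Equiv.Perm (Fin n)) : Matrix.orthogonalGroup (Fin n) ℝ :=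
  ⟨σ.permMatrix ℝ, by
    rw [Matrix.mem_orthogonalGroup_iff, Matrix.transpose_permMatrix, ← Matrix.permMatrix_mul]
    simp⟩

theorem firstCols_orthogonalPerm_mul {n ℓ : ℕ} (hℓ : ℓ ≤ n) (σ : Equiv.Perm (Fin n))
    (H : Matrix.orthogonalGroup (Fin n) ℝ) :
    firstCols ℓ hℓ ((orthogonalPerm σ * H : Matrix.orthogonalGroup (Fin n) ℝ) :
      Matrix (Fin n) (Fin n) ℝ) =
      (firstCols ℓ hℓ (H : Matrix (Fin n) (Fin n) ℝ)).submatrix σ id := by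
  have h : ((orthogonalPerm σ * H : Matrix.orthogonalGroup (Fin n) ℝ) :
      Matrix (Fin n) (Fin n) ℝ) = (H : Matrix (Fin n) (Fin n) ℝ).submatrix σ id :=
    PEquiv.toMatrix_toPEquiv_mul _ _
  rw [h]
  rfl

section SketchEntries

variable {n ℓ k : ℕ}

theorem sum_sq_entry_firstCols_mul (hℓ : ℓ ≤ n) (hk : k ≤ ℓ)
    (Q : Matrix.orthogonalGroup (Fin ℓ) ℝ) (H : Matrix.orthogonalGroup (Fin n) ℝ) (i : Fin k) :
    ∑ j, (firstCols ℓ hℓ (H : Matrix (Fin n) (Fin n) ℝ) *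
      firstCols k hk (Q : Matrix (Fin ℓ) (Fin ℓ) ℝ)) j i ^ 2 = 1 := by
  set A := firstCols ℓ hℓ (H : Matrix (Fin n) (Fin n) ℝ) with hA
  set B := firstCols k hk (Q : Matrix (Fin ℓ) (Fin ℓ) ℝ) with hB
  have h : (A * B)ᵀ * (A * B) = 1 := by
    rw [Matrix.transpose_mul, Matrix.mul_assoc, ← Matrix.mul_assoc Aᵀ,
      transpose_firstCols_mul_firstCols, Matrix.one_mul, transpose_firstCols_mul_firstCols]
  have h' := congrFun (congrFun h i) i
  rw [Matrix.mul_apply, Matrix.one_apply_eq] at h'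
  rw [← h']
  exact Finset.sum_congr rfl fun j _ => by rw [Matrix.transpose_apply, sq]

theorem continuous_entry_firstCols_mul (hℓ : ℓ ≤ n) (hk : k ≤ ℓ) (j : Fin n) (i : Fin k) :
    Continuous fun QH : Matrix.orthogonalGroup (Fin ℓ) ℝ × Matrix.orthogonalGroup (Fin n) ℝ =>
      (firstCols ℓ hℓ (QH.2 : Matrix (Fin n) (Fin n) ℝ) *
        firstCols k hk (QH.1 : Matrix (Fin ℓ) (Fin ℓ) ℝ)) j i := by
  have h : Continuous fun QH : Matrix.orthogonalGroup (Fin ℓ) ℝ ×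
      Matrix.orthogonalGroup (Fin n) ℝ =>
      firstCols ℓ hℓ (QH.2 : Matrix (Fin n) (Fin n) ℝ) *
        firstCols k hk (QH.1 : Matrix (Fin ℓ) (Fin ℓ) ℝ) :=
    ((continuous_subtype_val.comp continuous_snd).matrix_submatrix _ _).matrix_mul
      ((continuous_subtype_val.comp continuous_fst).matrix_submatrix _ _)
  exact h.matrix_elem j i

variable (μQ : Measure (Matrix.orthogonalGroup (Fin ℓ) ℝ)) [IsProbabilityMeasure μQ]
  (μH : Measure (Matrix.orthogonalGroup (Fin n) ℝ)) [IsProbabilityMeasure μH]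

theorem integrable_sq_entry_firstCols_mul (hℓ : ℓ ≤ n) (hk : k ≤ ℓ) (j : Fin n) (i : Fin k) :
    Integrable (fun QH : Matrix.orthogonalGroup (Fin ℓ) ℝ × Matrix.orthogonalGroup (Fin n) ℝ =>
      (firstCols ℓ hℓ (QH.2 : Matrix (Fin n) (Fin n) ℝ) *
        firstCols k hk (QH.1 : Matrix (Fin ℓ) (Fin ℓ) ℝ)) j i ^ 2) (μQ.prod μH) := by
  refine Integrable.of_bound
    ((continuous_entry_firstCols_mul hℓ hk j i).pow 2).measurable.aestronglyMeasurable 1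
    (ae_of_all _ fun QH => ?_)
  rw [Real.norm_of_nonneg (sq_nonneg _), ← sum_sq_entry_firstCols_mul hℓ hk QH.1 QH.2 i]
  exact Finset.single_le_sum (f := fun j => (firstCols ℓ hℓ (QH.2 : Matrix (Fin n) (Fin n) ℝ) *
    firstCols k hk (QH.1 : Matrix (Fin ℓ) (Fin ℓ) ℝ)) j i ^ 2)
    (fun _ _ => sq_nonneg _) (Finset.mem_univ j)

/-- Under Haar measure each coordinate of a unit vector in the range has second moment `1 / n`. -/
theorem integral_sq_entry_firstCols_mul [μQ.IsHaarMeasure] [μH.IsHaarMeasure]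
    (hℓ : ℓ ≤ n) (hk : k ≤ ℓ) (j : Fin n) (i : Fin k) :
    ∫ QH : Matrix.orthogonalGroup (Fin ℓ) ℝ × Matrix.orthogonalGroup (Fin n) ℝ,
      (firstCols ℓ hℓ (QH.2 : Matrix (Fin n) (Fin n) ℝ) *
        firstCols k hk (QH.1 : Matrix (Fin ℓ) (Fin ℓ) ℝ)) j i ^ 2 ∂(μQ.prod μH) = 1 / n := by
  set f : Fin n → Matrix.orthogonalGroup (Fin ℓ) ℝ × Matrix.orthogonalGroup (Fin n) ℝ → ℝ :=
    fun j QH => (firstCols ℓ hℓ (QH.2 : Matrix (Fin n) (Fin n) ℝ) *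
      firstCols k hk (QH.1 : Matrix (Fin ℓ) (Fin ℓ) ℝ)) j i ^ 2 with hf
  have hswap : ∀ j', ∫ QH, f j' QH ∂(μQ.prod μH) = ∫ QH, f j QH ∂(μQ.prod μH) := by
    intro j'
    rw [← integral_mul_left_eq_self (μ := μQ.prod μH) (f j) (1, orthogonalPerm (Equiv.swap j j'))]
    refine integral_congr_ae (ae_of_all _ fun QH => ?_)
    simp only [hf, Prod.fst_mul, Prod.snd_mul, one_mul, firstCols_orthogonalPerm_mul]
    congr 1
    simp [Matrix.mul_apply]
  have hsum : ∑ j', ∫ QH, f j' QH ∂(μQ.prod μH) = 1 := by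
    rw [← integral_finsetSum _ fun j' _ =>
      integrable_sq_entry_firstCols_mul μQ μH hℓ hk j' i]
    simp only [sum_sq_entry_firstCols_mul]
    simp
  rw [Finset.sum_congr rfl fun j' _ => hswap j', Finset.sum_const, Finset.card_univ,
    Fintype.card_fin, nsmul_eq_mul] at hsum
  have hn : (n : ℝ) ≠ 0 := by
    intro h
    simp [h] at hsum
  rw [eq_div_iff hn, mul_comm]
  exact hsum

end SketchEntries

/-- Let `k ≥ 1`, `p ≥ 0`, `k + p ≤ N − k`, let `Σ₁`, `Σ₂` be diagonal with strictly
positive diagonals, let `Q` and `H` be independent Haar-distributed orthogonal matrices on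
`O(k+p)` and `O(N−k)`, and let `Q₁`, `H₁` be the first `k` and `k+p` columns of `Q`, `H`
respectively. Then `H₁ᵀ Σ₂² H₁` and `Q₁ᵀ (H₁ᵀ Σ₂² H₁)⁻¹ Q₁` are positive definite, and
`𝔼[tr(Σ₁⁻² (Q₁ᵀ (H₁ᵀ Σ₂² H₁)⁻¹ Q₁)⁻¹)] ≤ tr(Σ₁⁻²) tr(Σ₂²) / (N−k)`. -/
theorem expectation_trace_sketch_bound (N k p : ℕ) (hk1 : 1 ≤ k) (hkpN : k + p ≤ N - k)
    (d₁ : Fin k → ℝ) (hd₁ : ∀ i, 0 < d₁ i)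
    (d₂ : Fin (N - k) → ℝ) (hd₂ : ∀ i, 0 < d₂ i)
    (μQ : Measure (Matrix.orthogonalGroup (Fin (k + p)) ℝ))
    [μQ.IsHaarMeasure] [IsProbabilityMeasure μQ]
    (μH : Measure (Matrix.orthogonalGroup (Fin (N - k)) ℝ))
    [μH.IsHaarMeasure] [IsProbabilityMeasure μH] :
    (∀ H : Matrix.orthogonalGroup (Fin (N - k)) ℝ,
      ((firstCols (k + p) hkpN (H : Matrix (Fin (N - k)) (Fin (N - k)) ℝ))ᵀ *
          (Matrix.diagonal d₂) ^ 2 *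
          firstCols (k + p) hkpN (H : Matrix (Fin (N - k)) (Fin (N - k)) ℝ)).PosDef) ∧
    (∀ (Q : Matrix.orthogonalGroup (Fin (k + p)) ℝ)
        (H : Matrix.orthogonalGroup (Fin (N - k)) ℝ),
      ((firstCols k (Nat.le_add_right k p) (Q : Matrix (Fin (k + p)) (Fin (k + p)) ℝ))ᵀ *
          ((firstCols (k + p) hkpN (H : Matrix (Fin (N - k)) (Fin (N - k)) ℝ))ᵀ *
              (Matrix.diagonal d₂) ^ 2 *
              firstCols (k + p) hkpN (H : Matrix (Fin (N - k)) (Fin (N - k)) ℝ))⁻¹ *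
          firstCols k (Nat.le_add_right k p)
            (Q : Matrix (Fin (k + p)) (Fin (k + p)) ℝ)).PosDef) ∧
    ∫ QH : Matrix.orthogonalGroup (Fin (k + p)) ℝ × Matrix.orthogonalGroup (Fin (N - k)) ℝ,
        (((Matrix.diagonal d₁) ^ 2)⁻¹ *
            ((firstCols k (Nat.le_add_right k p)
                  (QH.1 : Matrix (Fin (k + p)) (Fin (k + p)) ℝ))ᵀ *
                ((firstCols (k + p) hkpN (QH.2 : Matrix (Fin (N - k)) (Fin (N - k)) ℝ))ᵀ *
                    (Matrix.diagonal d₂) ^ 2 *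
                    firstCols (k + p) hkpN
                      (QH.2 : Matrix (Fin (N - k)) (Fin (N - k)) ℝ))⁻¹ *
                firstCols k (Nat.le_add_right k p)
                  (QH.1 : Matrix (Fin (k + p)) (Fin (k + p)) ℝ))⁻¹).trace
        ∂(μQ.prod μH)
      ≤ ((Matrix.diagonal d₁) ^ 2)⁻¹.trace * ((Matrix.diagonal d₂) ^ 2).trace /
          ((N : ℝ) - k) := by
  have hM : ∀ H : Matrix.orthogonalGroup (Fin (N - k)) ℝ,
      ((firstCols (k + p) hkpN (H : Matrix (Fin (N - k)) (Fin (N - k)) ℝ))ᵀ *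
          (Matrix.diagonal d₂) ^ 2 *
          firstCols (k + p) hkpN (H : Matrix (Fin (N - k)) (Fin (N - k)) ℝ)).PosDef := by
    intro H
    refine Matrix.PosDef.transpose_mul_mul_of_transpose_mul_self_eq_one ?_
      (transpose_firstCols_mul_firstCols hkpN H)
    rw [Matrix.diagonal_pow]
    exact Matrix.PosDef.diagonal fun i => pow_pos (hd₂ i) 2
  have hS := fun (Q : Matrix.orthogonalGroup (Fin (k + p)) ℝ)
      (H : Matrix.orthogonalGroup (Fin (N - k)) ℝ) =>
    (hM H).inv.transpose_mul_mul_of_transpose_mul_self_eq_one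
      (transpose_firstCols_mul_firstCols (Nat.le_add_right k p) Q)
  refine ⟨hM, hS, ?_⟩
  have hNk : (N : ℝ) - k = ((N - k : ℕ) : ℝ) := by
    rw [Nat.cast_sub (by omega)]
  rw [Matrix.inv_diagonal_sq hd₁, hNk]
  have h_entry := fun (j : Fin (N - k)) (i : Fin k) => integrable_sq_entry_firstCols_mul μQ μH hkpN
    (Nat.le_add_right k p) j i
  have h_term : ∀ i : Fin k, Integrable (fun QH : Matrix.orthogonalGroup (Fin (k + p)) ℝ ×
      Matrix.orthogonalGroup (Fin (N - k)) ℝ => (d₁ i ^ 2)⁻¹ * ∑ j, d₂ j ^ 2 *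
        (firstCols (k + p) hkpN (QH.2 : Matrix (Fin (N - k)) (Fin (N - k)) ℝ) *
          firstCols k (Nat.le_add_right k p)
            (QH.1 : Matrix (Fin (k + p)) (Fin (k + p)) ℝ)) j i ^ 2) (μQ.prod μH) := fun i =>
    (integrable_finsetSum _ fun j _ => (h_entry j i).const_mul _).const_mul _
  refine (integral_mono_of_nonneg (ae_of_all _ fun QH => ?_)
    (integrable_finsetSum Finset.univ fun i _ => h_term i) (ae_of_all _ fun QH => ?_)).trans
    (le_of_eq ?_)
  · simp only [Pi.zero_apply, Matrix.trace, Matrix.diag_apply, Matrix.diagonal_mul]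
    exact Finset.sum_nonneg fun i _ =>
      mul_nonneg (inv_nonneg.2 (sq_nonneg _)) (hS QH.1 QH.2).inv.diag_pos.le
  · simp only [Matrix.trace, Matrix.diag_apply, Matrix.diagonal_mul]
    refine Finset.sum_le_sum fun i _ => mul_le_mul_of_nonneg_left ?_ (inv_nonneg.2 (sq_nonneg _))
    refine ((hM QH.2).inv_compression_inv_diag_le
      (transpose_firstCols_mul_firstCols (Nat.le_add_right k p) QH.1) i).trans (le_of_eq ?_)
    set A := firstCols (k + p) hkpN (QH.2 : Matrix (Fin (N - k)) (Fin (N - k)) ℝ)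
    set B := firstCols k (Nat.le_add_right k p) (QH.1 : Matrix (Fin (k + p)) (Fin (k + p)) ℝ)
    have h : Bᵀ * (Aᵀ * Matrix.diagonal d₂ ^ 2 * A) * B =
        (A * B)ᵀ * (Matrix.diagonal d₂ ^ 2 * (A * B)) := by
      simp only [Matrix.transpose_mul, Matrix.mul_assoc]
    rw [h, Matrix.diagonal_pow, Matrix.mul_apply]
    refine Finset.sum_congr rfl fun j _ => ?_
    rw [Matrix.diagonal_mul, Matrix.transpose_apply, Pi.pow_apply]
    ring
  · rw [integral_finsetSum _ fun i _ => h_term i]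
    simp only [integral_const_mul]
    rw [Matrix.diagonal_pow, Matrix.trace_diagonal, Matrix.trace_diagonal, mul_div_assoc,
      Finset.sum_mul]
    refine Finset.sum_congr rfl fun i _ => ?_
    rw [integral_finsetSum _ fun j _ => (h_entry j i).const_mul _, Finset.sum_div]
    congr 1
    refine Finset.sum_congr rfl fun j _ => ?_
    rw [integral_const_mul, integral_sq_entry_firstCols_mul, mul_one_div, Pi.pow_apply]
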